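/- arXiv:2311.18753 — 5 statements merged into one kernel-verified Lean document; each statement's English description precedes it below -/
import Mathlib

section
/- Let r ≥ 4 and let n, e be positive integers with t_{r−1}(n) < e ≤ C(n,2), and let k = k(n,e). Suppose G is a graph in H_0(n,e) with the minimum number of r-cliques among all graphs in H_0(n,e), and suppose V(G) = B_1 ∪ ... ∪ B_{k−1} is a partition such that G is the union of the complete (k−1)-partite graph K[B_1, ..., B_{k−1}] with a triangle-free graph. Then at most one index i ∈ [k−1] satisfies 0 < e(G[B_i]) < t_2(|B_i|). -/
/-- Number of edges of a (simple) graph. -/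
noncomputable def edgeCnt {V : Type*} (G : SimpleGraph V) : ℕ := G.edgeSet.ncard

/-- `NK G r` is the number of `r`-cliques in `G`. -/
noncomputable def NK {V : Type*} (G : SimpleGraph V) (r : ℕ) : ℕ :=
  {s : Finset V | G.IsNClique r s}.ncard

/-- Clique count with an integer index: `N(K_r, G) = 0` for `r < 0`. -/
noncomputable def NKZ {V : Type*} (G : SimpleGraph V) (r : ℤ) : ℕ :=
  if r < 0 then 0 else NK G r.toNat

/-- `tur s n` is the number of edges of the Turán graph `T_s(n)`. -/
noncomputable def tur (s n : ℕ) : ℕ := edgeCnt (SimpleGraph.turanGraph n s)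

/-- `kk n e = k(n,e)`, the least `s ≥ 1` with `t_s(n) ≥ e`. -/
noncomputable def kk (n e : ℕ) : ℕ := sInf {s : ℕ | 1 ≤ s ∧ e ≤ tur s n}

/-- `a_k*(n,e)`, the least `a ≥ 1` with `a(n-a) + t_{k-1}(n-a) ≥ e`. -/
noncomputable def aLast (n e : ℕ) : ℕ :=
  sInf {a : ℕ | 1 ≤ a ∧ e ≤ a * (n - a) + tur (kk n e - 1) (n - a)}

/-- `aStar n e i = a_i*(n,e)` for `i ∈ [k]` (1-indexed):
the unique vector with `a_k* = aLast n e`, `a_1* + ⋯ + a_{k-1}* = n - a_k*` and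
`a_1* ≥ ⋯ ≥ a_{k-1}* ≥ a_1* - 1`. -/
noncomputable def aStar (n e i : ℕ) : ℕ :=
  if i = kk n e then aLast n e
  else (n - aLast n e) / (kk n e - 1) +
    (if i ≤ (n - aLast n e) % (kk n e - 1) then 1 else 0)

/-- `m*(n,e) = Σ_{i<j} a_i* a_j* - e` (as a natural number). -/
noncomputable def mStar (n e : ℕ) : ℕ :=
  (∑ p ∈ (Finset.Icc 1 (kk n e)).powersetCard 2, ∏ i ∈ p, aStar n e i) - e

/-- `m*(n,e) = Σ_{i<j} a_i* a_j* - e` (as an integer). -/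
noncomputable def mStarZ (n e : ℕ) : ℤ :=
  (∑ p ∈ (Finset.Icc 1 (kk n e)).powersetCard 2, ∏ i ∈ p, (aStar n e i : ℤ)) - (e : ℤ)

/-- `h_r*(n,e) = Σ_{I ⊆ [k], |I|=r} Π_{i∈I} a_i* - m* Σ_{I' ⊆ [k-2], |I'|=r-2} Π_{j∈I'} a_j*`. -/
noncomputable def hStar (n e r : ℕ) : ℤ :=
  (∑ I ∈ (Finset.Icc 1 (kk n e)).powersetCard r, ∏ i ∈ I, (aStar n e i : ℤ)) -
    (mStar n e : ℤ) *
      ∑ I ∈ (Finset.Icc 1 (kk n e - 2)).powersetCard (r - 2), ∏ i ∈ I, (aStar n e i : ℤ)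

/-- Membership in the family `K(n,e)`: `(n,e)`-graphs obtained from a complete multipartite
graph by adding a triangle-free graph into one part. -/
def MemK (n e : ℕ) (G : SimpleGraph (Fin n)) : Prop :=
  edgeCnt G = e ∧
  ∃ (c : Fin n → ℕ) (j₀ : ℕ),
    (∀ u v, c u ≠ c v → G.Adj u v) ∧
    (∀ u v, G.Adj u v → c u = c v → c u = j₀) ∧
    (G.induce {v | c v = j₀}).CliqueFree 3

/-- Membership in the family `H_1(n,e)`: `(n,e)`-graphs obtained from a complete
`(k-1)`-partite graph by adding a triangle-free graph into one part. -/
def MemH1 (n e : ℕ) (G : SimpleGraph (Fin n)) : Prop :=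
  edgeCnt G = e ∧
  ∃ (c : Fin n → Fin (kk n e - 1)) (j₀ : Fin (kk n e - 1)),
    (∀ u v, c u ≠ c v → G.Adj u v) ∧
    (∀ u v, G.Adj u v → c u = c v → c u = j₀) ∧
    (G.induce {v | c v = j₀}).CliqueFree 3

/-- Membership in the family `H_0(n,e)`: `(n,e)`-graphs obtained from a complete
`(k-1)`-partite graph by adding a (possibly empty) triangle-free graph into each part. -/
def MemH0 (n e : ℕ) (G : SimpleGraph (Fin n)) : Prop :=
  edgeCnt G = e ∧
  ∃ c : Fin n → Fin (kk n e - 1),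
    (∀ u v, c u ≠ c v → G.Adj u v) ∧
    ∀ j, (G.induce {v | c v = j}).CliqueFree 3

/-- Membership (up to isomorphism) in the family `H_1*(n,e)`: graphs obtained from the
complete `k`-partite graph with part sizes `a_1*, …, a_k*` by replacing, for some
`i ∈ [k-1]` (with `i = k-1` if `m* > 0`), the complete bipartite graph between parts `i`
and `k` by an arbitrary triangle-free graph on the union of these two parts with
`a_i* a_k* - m*` edges. -/
def MemH1star (n e : ℕ) (G : SimpleGraph (Fin n)) : Prop :=
  edgeCnt G = e ∧
  ∃ (c : Fin n → ℕ) (i : ℕ),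
    (∀ v, c v ∈ Finset.Icc 1 (kk n e)) ∧
    (∀ j ∈ Finset.Icc 1 (kk n e), {v | c v = j}.ncard = aStar n e j) ∧
    i ∈ Finset.Icc 1 (kk n e - 1) ∧
    (0 < mStar n e → i = kk n e - 1) ∧
    (∀ u v, c u ≠ c v →
      (c u ∉ ({i, kk n e} : Set ℕ) ∨ c v ∉ ({i, kk n e} : Set ℕ)) → G.Adj u v) ∧
    (∀ u v, G.Adj u v → c u = c v → c u = i ∨ c u = kk n e) ∧
    (G.induce {v | c v = i ∨ c v = kk n e}).CliqueFree 3

/-- Membership (up to isomorphism) in the family `H_2*(n,e)`. -/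
def MemH2star (n e : ℕ) (G : SimpleGraph (Fin n)) : Prop :=
  (MemH1star n e G ∧ G.Colorable (kk n e)) ∨
  (edgeCnt G = e ∧
   ∃ (c : Fin n → ℕ) (sz : ℕ → ℕ) (f : Fin n → ℕ),
     ((∀ j, sz j = aStar n e j) ∨
      (mStar n e = 0 ∧ aStar n e (kk n e) + 2 ≤ aStar n e 1 ∧
       (∀ j ∈ Finset.Icc 1 (kk n e - 2), sz j = aStar n e (j + 1)) ∧
       sz (kk n e - 1) = aStar n e 1 - 1 ∧ sz (kk n e) = aStar n e (kk n e) + 1)) ∧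
     (∀ v, c v ∈ Finset.Icc 1 (kk n e)) ∧
     (∀ j ∈ Finset.Icc 1 (kk n e), {v | c v = j}.ncard = sz j) ∧
     (∀ u v, G.Adj u v → c u ≠ c v) ∧
     (∀ u v, c u ≠ c v → ¬ G.Adj u v → c v = kk n e →
        c u ∈ Finset.Icc 1 (kk n e - 1) ∧ sz (c u) = sz (kk n e - 1) ∧ c u = f v) ∧
     (∀ u v, c u ≠ c v → ¬ G.Adj u v → c u = kk n e ∨ c v = kk n e))

/-- Partial sums of the part sizes `a_i*`. -/
noncomputable def csum (n e j : ℕ) : ℕ := ∑ i ∈ Finset.Icc 1 j, aStar n e i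

/-- The part (in `[k]`) of the vertex with index `v` in the canonical construction. -/
noncomputable def partOf (n e v : ℕ) : ℕ := sInf {j : ℕ | v < csum n e j}

/-- The graph `H*(n,e)`: the complete `k`-partite graph with part sizes `a_1*, …, a_k*`
minus an `m*`-edge star whose centre lies in part `k` and whose leaves lie in part `k-1`. -/
noncomputable def HstarG (n e : ℕ) : SimpleGraph (Fin n) :=
  SimpleGraph.fromRel (fun u v =>
    partOf n e u ≠ partOf n e v ∧
    ¬ (((u : ℕ) = csum n e (kk n e - 1) ∧
          csum n e (kk n e - 2) ≤ (v : ℕ) ∧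
          (v : ℕ) < csum n e (kk n e - 2) + mStar n e) ∨
       ((v : ℕ) = csum n e (kk n e - 1) ∧
          csum n e (kk n e - 2) ≤ (u : ℕ) ∧
          (u : ℕ) < csum n e (kk n e - 2) + mStar n e)))

/-- `g_r(n,e)`: the minimum number of `r`-cliques among all graphs with `n` vertices and
`e` edges. -/
noncomputable def gMin (n e r : ℕ) : ℕ :=
  sInf {N : ℕ | ∃ G : SimpleGraph (Fin n), edgeCnt G = e ∧ NK G r = N}

open Classical in
/-- The number of `p`-cliques of `G` contained in the vertex set `X`. -/
noncomputable def cliqueCount {V : Type*} (G : SimpleGraph V) (X : Finset V) (p : ℕ) : ℕ :=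
  (X.powerset.filter (G.IsNClique p)).card

section CliqueCount

variable {V : Type*} {G H : SimpleGraph V} {X Y : Finset V}

theorem cliqueCount_congr (h : ∀ u ∈ X, ∀ v ∈ X, G.Adj u v ↔ H.Adj u v) (p : ℕ) :
    cliqueCount G X p = cliqueCount H X p := by
  classical
  unfold cliqueCount
  congr 1
  refine Finset.filter_congr fun s hs => ?_
  have hs := Finset.mem_powerset.1 hs
  simp only [SimpleGraph.isNClique_iff, SimpleGraph.isClique_iff, Set.Pairwise, Finset.mem_coe]
  refine and_congr_left fun _ => ?_
  exact ⟨fun k u hu v hv n => (h u (hs hu) v (hs hv)).1 (k hu hv n),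
    fun k u hu v hv n => (h u (hs hu) v (hs hv)).2 (k hu hv n)⟩

theorem cliqueCount_zero : cliqueCount G X 0 = 1 := by
  classical
  unfold cliqueCount
  rw [Finset.card_eq_one]
  refine ⟨∅, ?_⟩
  ext s
  simp only [Finset.mem_filter, Finset.mem_powerset, SimpleGraph.isNClique_zero,
    Finset.mem_singleton]
  exact ⟨fun h => h.2, fun h => ⟨by simp [h], h⟩⟩

theorem cliqueCount_one : cliqueCount G X 1 = X.card := by
  classical
  unfold cliqueCount
  rw [← Finset.card_map (s := X) ⟨singleton, Finset.singleton_injective⟩]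
  congr 1
  ext s
  simp only [Finset.mem_filter, Finset.mem_powerset, SimpleGraph.isNClique_one, Finset.mem_map,
    Function.Embedding.coeFn_mk]
  constructor
  · rintro ⟨hs, a, rfl⟩
    exact ⟨a, by simpa using hs, rfl⟩
  · rintro ⟨a, ha, rfl⟩
    exact ⟨by simpa using ha, a, rfl⟩

theorem cliqueCount_eq_zero {p q : ℕ} (h : G.CliqueFreeOn X p) (hpq : p ≤ q) :
    cliqueCount G X q = 0 := by
  classical
  unfold cliqueCount
  rw [Finset.card_eq_zero, Finset.filter_eq_empty_iff]
  intro s hs hq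
  have hs := Finset.mem_powerset.1 hs
  obtain ⟨t, hts, ht⟩ := Finset.exists_subset_card_eq (hq.card_eq.symm ▸ hpq : p ≤ s.card)
  exact h (Finset.coe_subset.2 (hts.trans hs)) ⟨hq.isClique.subset (by simpa using hts), ht⟩

theorem cliqueCount_pos {s : Finset V} (hs : s ⊆ X) {p : ℕ} (hc : G.IsClique s)
    (hp : p ≤ s.card) : 0 < cliqueCount G X p := by
  classical
  obtain ⟨t, hts, ht⟩ := Finset.exists_subset_card_eq hp
  refine Finset.card_pos.2 ⟨t, Finset.mem_filter.2 ⟨Finset.mem_powerset.2 (hts.trans hs), ?_⟩⟩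
  exact ⟨hc.subset (by simpa using hts), ht⟩

theorem NK_eq_cliqueCount_univ [Fintype V] (p : ℕ) : NK G p = cliqueCount G Finset.univ p := by
  classical
  unfold NK cliqueCount
  rw [← Set.ncard_coe_finset]
  congr 1
  ext s
  simp

theorem NK_induce {S : Set V} (hX : ∀ v, v ∈ X ↔ v ∈ S) (p : ℕ) :
    NK (G.induce S) p = cliqueCount G X p := by
  classical
  unfold NK cliqueCount
  rw [← Set.ncard_coe_finset, ← Set.ncard_image_of_injective _
    (Finset.map_injective (Function.Embedding.subtype (· ∈ S)))]
  congr 1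
  ext s
  simp only [Set.mem_image, Set.mem_ofPred_eq, Finset.coe_filter, Finset.mem_powerset,
    SimpleGraph.isNClique_induce_iff]
  constructor
  · rintro ⟨t, ht, rfl⟩
    refine ⟨fun v hv => ?_, ht⟩
    obtain ⟨w, _, rfl⟩ := Finset.mem_map.1 hv
    exact (hX _).2 w.2
  · rintro ⟨hs, hc⟩
    have : (s.subtype (· ∈ S)).map (Function.Embedding.subtype (· ∈ S)) = s :=
      Finset.subtype_map_of_mem fun v hv => (hX v).1 (hs hv)
    exact ⟨s.subtype (· ∈ S), by rw [this]; exact hc, this⟩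

theorem edgeCnt_eq_NK_two : edgeCnt G = NK G 2 := by
  classical
  have hinj : Function.Injective (Sym2.toFinset : Sym2 V → Finset V) := by
    intro a b h
    ext v
    rw [← Sym2.mem_toFinset, h, Sym2.mem_toFinset]
  unfold edgeCnt NK
  rw [← Set.ncard_image_of_injective _ hinj]
  congr 1
  ext s
  simp only [Set.mem_image, Set.mem_ofPred_eq]
  constructor
  · rintro ⟨z, hz, rfl⟩
    induction z with
    | _ u v =>
      rw [SimpleGraph.mem_edgeSet] at hz
      rw [Sym2.toFinset_mk_eq]
      refine ⟨?_, Finset.card_pair hz.ne⟩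
      simp [SimpleGraph.isClique_iff, hz]
  · rintro ⟨hc, h2⟩
    obtain ⟨u, v, huv, rfl⟩ := Finset.card_eq_two.1 h2
    exact ⟨s(u, v), hc (by simp) (by simp) huv, Sym2.toFinset_mk_eq⟩

theorem edgeCnt_induce {S : Set V} (hX : ∀ v, v ∈ X ↔ v ∈ S) :
    edgeCnt (G.induce S) = cliqueCount G X 2 := by
  rw [edgeCnt_eq_NK_two, NK_induce hX]

/-- Cliques of a join are unions of cliques of the two sides. -/
theorem cliqueCount_union [DecidableEq V] (hXY : Disjoint X Y)
    (h : ∀ u ∈ X, ∀ v ∈ Y, G.Adj u v) (r : ℕ) :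
    cliqueCount G (X ∪ Y) r =
      ∑ pq ∈ Finset.HasAntidiagonal.antidiagonal r, cliqueCount G X pq.1 * cliqueCount G Y pq.2 := by
  classical
  unfold cliqueCount
  simp_rw [← Finset.card_product]
  rw [← Finset.card_sigma]
  symm
  refine Finset.card_nbij' (fun z => z.2.1 ∪ z.2.2)
    (fun u => ⟨((u ∩ X).card, (u ∩ Y).card), (u ∩ X, u ∩ Y)⟩) ?_ ?_ ?_ ?_
  · rintro ⟨⟨p, q⟩, s, t⟩ hz
    simp only [Finset.coe_sigma, Set.mem_sigma_iff, Finset.mem_coe, Finset.HasAntidiagonal.mem_antidiagonal,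
      Finset.mem_product, Finset.mem_filter, Finset.mem_powerset] at hz ⊢
    obtain ⟨hpq, ⟨hs, hsc, hsp⟩, ht, htc, htq⟩ := hz
    refine ⟨Finset.union_subset_union hs ht, ?_, ?_⟩
    · intro u hu v hv huv
      rcases Finset.mem_union.1 (Finset.mem_coe.1 hu) with hu | hu <;>
        rcases Finset.mem_union.1 (Finset.mem_coe.1 hv) with hv | hv
      · exact hsc hu hv huv
      · exact h u (hs hu) v (ht hv)
      · exact (h v (hs hv) u (ht hu)).symm
      · exact htc hu hv huv
    · rw [Finset.card_union_of_disjoint (hXY.mono hs ht), hsp, htq, hpq]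
  · intro u hu
    simp only [Finset.coe_sigma, Set.mem_sigma_iff, Finset.mem_coe, Finset.HasAntidiagonal.mem_antidiagonal,
      Finset.mem_product, Finset.mem_filter, Finset.mem_powerset] at hu ⊢
    obtain ⟨hu, huc, hur⟩ := hu
    refine ⟨?_, ⟨Finset.inter_subset_right, huc.subset (by simp), rfl⟩,
      Finset.inter_subset_right, huc.subset (by simp), rfl⟩
    rw [← Finset.card_union_of_disjoint (hXY.mono Finset.inter_subset_right
      Finset.inter_subset_right), ← Finset.inter_union_distrib_left,
      Finset.inter_eq_left.2 hu, hur]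
  · rintro ⟨⟨p, q⟩, s, t⟩ hz
    simp only [Finset.coe_sigma, Set.mem_sigma_iff, Finset.mem_coe, Finset.HasAntidiagonal.mem_antidiagonal,
      Finset.mem_product, Finset.mem_filter, Finset.mem_powerset] at hz
    obtain ⟨hpq, ⟨hs, hsc, hsp⟩, ht, htc, htq⟩ := hz
    have h1 : (s ∪ t) ∩ X = s := by
      rw [Finset.union_inter_distrib_right, Finset.inter_eq_left.2 hs,
        Finset.disjoint_iff_inter_eq_empty.1 (hXY.symm.mono_left ht), Finset.union_empty]
    have h2 : (s ∪ t) ∩ Y = t := by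
      rw [Finset.union_inter_distrib_right, Finset.inter_eq_left.2 ht,
        Finset.disjoint_iff_inter_eq_empty.1 (hXY.mono_left hs), Finset.empty_union]
    simp only [h1, h2, hsp, htq]
  · intro u hu
    simp only [Finset.mem_coe, Finset.mem_filter, Finset.mem_powerset] at hu
    simp only [← Finset.inter_union_distrib_left, Finset.inter_eq_left.2 hu.1]

/-- Clique counts of a join of two triangle-free graphs are given by the coefficients of
`(1 + |X| t + e(X) t²) (1 + |Y| t + e(Y) t²)`. -/
theorem cliqueCount_union_of_cliqueFreeOn [DecidableEq V] (hXY : Disjoint X Y)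
    (h : ∀ u ∈ X, ∀ v ∈ Y, G.Adj u v) (hX : G.CliqueFreeOn X 3) (hY : G.CliqueFreeOn Y 3)
    (p : ℕ) :
    cliqueCount G (X ∪ Y) p = match p with
      | 0 => 1
      | 1 => X.card + Y.card
      | 2 => cliqueCount G X 2 + X.card * Y.card + cliqueCount G Y 2
      | 3 => X.card * cliqueCount G Y 2 + cliqueCount G X 2 * Y.card
      | 4 => cliqueCount G X 2 * cliqueCount G Y 2
      | _ => 0 := by
  rw [cliqueCount_union hXY h]
  have hX' : ∀ q, 3 ≤ q → cliqueCount G X q = 0 := fun q => cliqueCount_eq_zero hX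
  have hY' : ∀ q, 3 ≤ q → cliqueCount G Y q = 0 := fun q => cliqueCount_eq_zero hY
  match p with
  | 0 => simp [cliqueCount_zero]
  | 1 => simp [Finset.Nat.antidiagonal_succ, cliqueCount_zero,
      cliqueCount_one, add_comm]
  | 2 =>
    simp [Finset.Nat.antidiagonal_succ, cliqueCount_zero, cliqueCount_one]
    ring
  | 3 =>
    simp [Finset.Nat.antidiagonal_succ, cliqueCount_zero, cliqueCount_one, hX', hY']
  | 4 =>
    simp [Finset.Nat.antidiagonal_succ, cliqueCount_zero, cliqueCount_one, hX', hY']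
  | p + 5 =>
    refine Finset.sum_eq_zero fun z hz => ?_
    have hz := Finset.HasAntidiagonal.mem_antidiagonal.1 hz
    by_cases h3 : 3 ≤ z.1
    · rw [hX' _ h3, zero_mul]
    · rw [hY' z.2 (by omega), mul_zero]

/-- Every number of edges up to `t_2(|X|)` is realised by a triangle-free graph on `X`. -/
theorem exists_cliqueFree_three_cliqueCount_eq (X : Finset V) {a : ℕ} (ha : a ≤ tur 2 X.card) :
    ∃ A : SimpleGraph V, A.CliqueFreeOn X 3 ∧ cliqueCount A X 2 = a := by
  classical
  obtain ⟨S, hS, rfl⟩ := Set.exists_subset_card_eq ha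
  let B : SimpleGraph (Fin X.card) := SimpleGraph.fromEdgeSet S
  have hBS : B.edgeSet = S := by
    rw [SimpleGraph.edgeSet_fromEdgeSet, sdiff_eq_left]
    exact Set.disjoint_left.2 fun z hz hd =>
      SimpleGraph.not_isDiag_of_mem_edgeSet _ (hS hz) hd
  have hB : B.CliqueFree 3 := by
    have hle : B ≤ SimpleGraph.turanGraph X.card 2 := by
      rw [← SimpleGraph.edgeSet_subset_edgeSet, hBS]
      exact hS
    exact (SimpleGraph.turanGraph_cliqueFree (by norm_num)).anti hle
  let f : X ≃ Fin X.card := X.equivFin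
  let A : SimpleGraph V := (B.comap f).map (Function.Embedding.subtype (· ∈ X))
  have hA : A.induce (X : Set V) = B.comap f := SimpleGraph.comap_map_eq _ _
  let φ : B.comap f ≃g B := SimpleGraph.Iso.comap f B
  refine ⟨A, ?_, ?_⟩
  · rw [← SimpleGraph.cliqueFree_induce_iff, hA]
    exact hB.comap φ.isContained
  · rw [← edgeCnt_induce (S := (X : Set V)) (by simp), hA]
    unfold edgeCnt
    rw [← hBS]
    exact Set.ncard_congr' φ.mapEdgeSet

end CliqueCount

/-- A graph with more edges than the Turán graph `T_{r-1}(n)` contains an `r`-clique. -/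
theorem not_cliqueFree_of_tur_lt {n r : ℕ} (hr : 2 ≤ r) {G : SimpleGraph (Fin n)}
    (h : tur (r - 1) n < edgeCnt G) : ¬ G.CliqueFree r := by
  classical
  intro hf
  have hmax := SimpleGraph.isTuranMaximal_turanGraph (n := n) (r := r - 1) (by omega)
  have hle := hmax.2 (G' := G) (by rwa [Nat.sub_add_cancel (by omega)])
  unfold tur edgeCnt at h
  rw [Set.ncard_eq_toFinset_card', Set.ncard_eq_toFinset_card'] at h
  exact absurd hle (not_le.2 h)

section JoinParts

variable {n : ℕ} {κ : Type*}

/-- The graph obtained from `G` by replacing the graph inside the colour classes `i` and `j`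
by `A` and `B` respectively. -/
def replaceParts (G A B : SimpleGraph (Fin n)) (c : Fin n → κ) (i j : κ) :
    SimpleGraph (Fin n) where
  Adj u v := (c u = i ∧ c v = i ∧ A.Adj u v) ∨ (c u = j ∧ c v = j ∧ B.Adj u v) ∨
    (¬ (c u = i ∧ c v = i) ∧ ¬ (c u = j ∧ c v = j) ∧ G.Adj u v)
  symm := ⟨fun u v h => by
    simp only [and_comm, and_left_comm, G.adj_comm, A.adj_comm, B.adj_comm] at h ⊢
    tauto⟩
  loopless := ⟨fun u h => by simp at h⟩

variable [DecidableEq κ] {G : SimpleGraph (Fin n)} {c : Fin n → κ} {i j : κ}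

/-- `G` is the join of the union of the parts `i`, `j` with the remaining parts. -/
theorem cliqueCount_univ_eq_sum (hcomp : ∀ u v, c u ≠ c v → G.Adj u v) (r : ℕ) :
    cliqueCount G Finset.univ r = ∑ pq ∈ Finset.HasAntidiagonal.antidiagonal r,
      cliqueCount G (Finset.univ.filter (c · = i) ∪ Finset.univ.filter (c · = j)) pq.1 *
      cliqueCount G (Finset.univ.filter fun v => c v ≠ i ∧ c v ≠ j) pq.2 := by
  rw [← cliqueCount_union]
  · congr 1
    ext v
    simp only [Finset.mem_univ, Finset.mem_union, Finset.mem_filter, true_and, true_iff]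
    tauto
  · rw [Finset.disjoint_left]
    simp only [Finset.mem_union, Finset.mem_filter, Finset.mem_univ, true_and]
    tauto
  · simp only [Finset.mem_union, Finset.mem_filter, Finset.mem_univ, true_and]
    rintro u (hu | hu) v ⟨h1, h2⟩ <;> apply hcomp <;> rw [hu]
    exacts [h1.symm, h2.symm]

/-- Edges inside two parts can be redistributed, keeping all parts triangle-free. -/
theorem exists_redistribute (hij : i ≠ j) (hcomp : ∀ u v, c u ≠ c v → G.Adj u v)
    (htf : ∀ l, (G.induce {v | c v = l}).CliqueFree 3) {a b : ℕ}
    (ha : a ≤ tur 2 (Finset.univ.filter (c · = i)).card)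
    (hb : b ≤ tur 2 (Finset.univ.filter (c · = j)).card) :
    ∃ H : SimpleGraph (Fin n), (∀ u v, c u ≠ c v → H.Adj u v) ∧
      (∀ l, (H.induce {v | c v = l}).CliqueFree 3) ∧
      cliqueCount H (Finset.univ.filter (c · = i)) 2 = a ∧
      cliqueCount H (Finset.univ.filter (c · = j)) 2 = b ∧
      ∀ p, cliqueCount H (Finset.univ.filter fun v => c v ≠ i ∧ c v ≠ j) p =
        cliqueCount G (Finset.univ.filter fun v => c v ≠ i ∧ c v ≠ j) p := by
  obtain ⟨A, hA, hAa⟩ := exists_cliqueFree_three_cliqueCount_eq _ ha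
  obtain ⟨B, hB, hBb⟩ := exists_cliqueFree_three_cliqueCount_eq _ hb
  have hAi : ∀ u v, c u = i → c v = i → ((replaceParts G A B c i j).Adj u v ↔ A.Adj u v) := by
    intro u v hu hv
    simp [replaceParts, hu, hv, hij]
  have hBj : ∀ u v, c u = j → c v = j → ((replaceParts G A B c i j).Adj u v ↔ B.Adj u v) := by
    intro u v hu hv
    simp [replaceParts, hu, hv, hij.symm]
  refine ⟨replaceParts G A B c i j, ?_, ?_, ?_, ?_, ?_⟩
  · intro u v huv
    refine Or.inr (Or.inr ⟨?_, ?_, hcomp u v huv⟩) <;> rintro ⟨h1, h2⟩ <;>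
      exact huv (h1.trans h2.symm)
  · intro l
    by_cases hli : l = i
    · subst hli
      have : (replaceParts G A B c l j).induce {v | c v = l} = A.induce {v | c v = l} := by
        ext ⟨u, hu⟩ ⟨v, hv⟩
        exact hAi u v hu hv
      rw [this, SimpleGraph.cliqueFree_induce_iff]
      simpa using hA
    by_cases hlj : l = j
    · subst hlj
      have : (replaceParts G A B c i l).induce {v | c v = l} = B.induce {v | c v = l} := by
        ext ⟨u, hu⟩ ⟨v, hv⟩
        exact hBj u v hu hv
      rw [this, SimpleGraph.cliqueFree_induce_iff]
      simpa using hB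
    · have : (replaceParts G A B c i j).induce {v | c v = l} = G.induce {v | c v = l} := by
        ext ⟨u, hu⟩ ⟨v, hv⟩
        simp only [Set.mem_ofPred_eq] at hu hv
        simp [replaceParts, hu, hli, hlj]
      rw [this]
      exact htf l
  · rw [← hAa]
    refine cliqueCount_congr (fun u hu v hv => ?_) 2
    exact hAi u v (by simpa using hu) (by simpa using hv)
  · rw [← hBb]
    refine cliqueCount_congr (fun u hu v hv => ?_) 2
    exact hBj u v (by simpa using hu) (by simpa using hv)
  · refine cliqueCount_congr fun u hu v hv => ?_
    simp only [Finset.mem_filter, Finset.mem_univ, true_and] at hu hv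
    simp [replaceParts, hu]

theorem cliqueFreeOn_part (htf : ∀ l, (G.induce {v | c v = l}).CliqueFree 3) (l : κ) :
    G.CliqueFreeOn (Finset.univ.filter (c · = l)) 3 := by
  simpa [SimpleGraph.cliqueFree_induce_iff] using htf l

theorem cliqueCount_two_parts (hij : i ≠ j) (hcomp : ∀ u v, c u ≠ c v → G.Adj u v)
    (htf : ∀ l, (G.induce {v | c v = l}).CliqueFree 3) (p : ℕ) :
    cliqueCount G (Finset.univ.filter (c · = i) ∪ Finset.univ.filter (c · = j)) p =
      match p with
      | 0 => 1
      | 1 => (Finset.univ.filter (c · = i)).card + (Finset.univ.filter (c · = j)).card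
      | 2 => cliqueCount G (Finset.univ.filter (c · = i)) 2 +
          (Finset.univ.filter (c · = i)).card * (Finset.univ.filter (c · = j)).card +
          cliqueCount G (Finset.univ.filter (c · = j)) 2
      | 3 => (Finset.univ.filter (c · = i)).card *
            cliqueCount G (Finset.univ.filter (c · = j)) 2 +
          cliqueCount G (Finset.univ.filter (c · = i)) 2 *
            (Finset.univ.filter (c · = j)).card
      | 4 => cliqueCount G (Finset.univ.filter (c · = i)) 2 *
          cliqueCount G (Finset.univ.filter (c · = j)) 2
      | _ => 0 := by
  apply cliqueCount_union_of_cliqueFreeOn _ _ (cliqueFreeOn_part htf i) (cliqueFreeOn_part htf j)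
  · rw [Finset.disjoint_left]
    simp only [Finset.mem_filter, Finset.mem_univ, true_and]
    rintro v rfl
    exact hij
  · simp only [Finset.mem_filter, Finset.mem_univ, true_and]
    rintro u hu v hv
    exact hcomp u v (by rwa [hu, hv])

/-- A clique of size `r` leaves at least `r - 4` vertices outside two triangle-free parts. -/
theorem cliqueCount_rest_pos (htf : ∀ l, (G.induce {v | c v = l}).CliqueFree 3) {r : ℕ}
    (hG : ¬ G.CliqueFree r) :
    0 < cliqueCount G (Finset.univ.filter fun v => c v ≠ i ∧ c v ≠ j) (r - 4) := by
  simp only [SimpleGraph.CliqueFree, not_forall, not_not] at hG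
  obtain ⟨s, hs⟩ := hG
  have hpart : ∀ l, (s.filter (c · = l)).card ≤ 2 := by
    intro l
    by_contra! hcard
    obtain ⟨t, hts, ht⟩ := Finset.exists_subset_card_eq (show 3 ≤ _ from hcard)
    refine cliqueFreeOn_part htf l (Finset.coe_subset.2
      (hts.trans (Finset.filter_subset_filter _ (Finset.subset_univ s))))
      ⟨hs.isClique.subset ?_, ht⟩
    exact Finset.coe_subset.2 (hts.trans (Finset.filter_subset _ _))
  refine cliqueCount_pos (s := s.filter fun v => c v ≠ i ∧ c v ≠ j)
    (Finset.filter_subset_filter _ (Finset.subset_univ s))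
    (hs.isClique.subset (Finset.coe_subset.2 (Finset.filter_subset _ _))) ?_
  have hsub : s ⊆ (s.filter (c · = i) ∪ s.filter (c · = j)) ∪
      s.filter fun v => c v ≠ i ∧ c v ≠ j := by
    intro v hv
    simp only [Finset.mem_union, Finset.mem_filter, hv, true_and]
    tauto
  have h1 := (Finset.card_le_card hsub).trans (Finset.card_union_le _ _)
  have h2 := Finset.card_union_le (s.filter (c · = i)) (s.filter (c · = j))
  have h3 := hs.card_eq
  have h4 := hpart i
  have h5 := hpart j
  omega

end JoinParts

/-- (Lemma 2.5) Let `r ≥ 4` and `t_{r-1}(n) < e ≤ C(n,2)`. If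
`G ∈ H_0(n,e)` has the minimum number of `r`-cliques among all graphs in `H_0(n,e)`, and
`V(G) = B_1 ∪ ⋯ ∪ B_{k-1}` is a partition (here `B_j = {v | c v = j}`) such that `G` is the
union of `K[B_1, …, B_{k-1}]` with a triangle-free graph, then at most one part `B_i` is
partially full, i.e. satisfies `0 < e(G[B_i]) < t_2(|B_i|)`. -/
theorem at_most_one_partially_full_part (n e r : ℕ) (hr : 4 ≤ r) (hn : 0 < n)
    (he1 : tur (r - 1) n < e) (he2 : e ≤ n.choose 2)
    (G : SimpleGraph (Fin n))
    (hG : MemH0 n e G)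
    (hmin : ∀ H : SimpleGraph (Fin n), MemH0 n e H → NK G r ≤ NK H r)
    (c : Fin n → Fin (kk n e - 1))
    (hcomp : ∀ u v, c u ≠ c v → G.Adj u v)
    (htf : ∀ j, (G.induce {v | c v = j}).CliqueFree 3) :
    ∀ i j : Fin (kk n e - 1),
      (0 < edgeCnt (G.induce {v | c v = i}) ∧
        edgeCnt (G.induce {v | c v = i}) < tur 2 {v | c v = i}.ncard) →
      (0 < edgeCnt (G.induce {v | c v = j}) ∧
        edgeCnt (G.induce {v | c v = j}) < tur 2 {v | c v = j}.ncard) →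
      i = j := by
  intro i j ⟨hi0, hi⟩ ⟨hj0, hj⟩
  by_contra hij
  have hmem : ∀ l v, v ∈ Finset.univ.filter (c · = l) ↔ v ∈ {v | c v = l} := by simp
  have hcard : ∀ l, {v | c v = l}.ncard = (Finset.univ.filter (c · = l)).card := by
    intro l
    rw [← Set.ncard_coe_finset]
    simp
  rw [edgeCnt_induce (hmem _)] at hi0 hi hj0 hj
  rw [hcard] at hi hj
  set a := cliqueCount G (Finset.univ.filter (c · = i)) 2 with ha
  set b := cliqueCount G (Finset.univ.filter (c · = j)) 2 with hb
  obtain ⟨P, hPc, hPt, hPi, hPj, hPr⟩ := exists_redistribute (a := a + 1) (b := b - 1)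
    hij hcomp htf (by omega) (by omega)
  obtain ⟨Q, hQc, hQt, hQi, hQj, hQr⟩ := exists_redistribute (a := a - 1) (b := b + 1)
    hij hcomp htf (by omega) (by omega)
  obtain ⟨a, ha'⟩ : ∃ a', a = a' + 1 := ⟨a - 1, by omega⟩
  obtain ⟨b, hb'⟩ : ∃ b', b = b' + 1 := ⟨b - 1, by omega⟩
  rw [ha'] at hPi hQi ha
  rw [hb'] at hPj hQj hb
  simp only [Nat.add_sub_cancel] at hPj hQi
  have hG2 : cliqueCount G Finset.univ 2 = e := by
    rw [← NK_eq_cliqueCount_univ, ← edgeCnt_eq_NK_two, hG.1]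
  have hmemH : ∀ H : SimpleGraph (Fin n), (∀ u v, c u ≠ c v → H.Adj u v) →
      (∀ l, (H.induce {v | c v = l}).CliqueFree 3) →
      cliqueCount H (Finset.univ.filter (c · = i)) 2 +
        cliqueCount H (Finset.univ.filter (c · = j)) 2 = (a + 1) + (b + 1) →
      (∀ p, cliqueCount H (Finset.univ.filter fun v => c v ≠ i ∧ c v ≠ j) p =
        cliqueCount G (Finset.univ.filter fun v => c v ≠ i ∧ c v ≠ j) p) → MemH0 n e H := by
    intro H hHc hHt hsum hHr
    refine ⟨?_, c, hHc, hHt⟩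
    rw [edgeCnt_eq_NK_two, NK_eq_cliqueCount_univ, ← hG2, cliqueCount_univ_eq_sum (i := i) (j := j) hHc,
      cliqueCount_univ_eq_sum (i := i) (j := j) hcomp]
    refine Finset.sum_congr rfl fun z hz => ?_
    rw [hHr]
    congr 1
    have hz := Finset.HasAntidiagonal.mem_antidiagonal.1 hz
    obtain ⟨p, q⟩ := z
    rw [cliqueCount_two_parts hij hHc hHt, cliqueCount_two_parts hij hcomp htf]
    have hp : p ≤ 2 := by simp only at hz; omega
    interval_cases p
    · rfl
    · rfl
    · simp only [← ha, ← hb]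
      omega
  have hPG := hmin P (hmemH P hPc hPt (by omega) hPr)
  have hQG := hmin Q (hmemH Q hQc hQt (by omega) hQr)
  have hrest : 0 < cliqueCount G (Finset.univ.filter fun v => c v ≠ i ∧ c v ≠ j) (r - 4) :=
    cliqueCount_rest_pos htf (not_cliqueFree_of_tur_lt (by omega) (by rwa [hG.1]))
  simp only [NK_eq_cliqueCount_univ] at hPG hQG
  have hlt : cliqueCount P Finset.univ r + cliqueCount Q Finset.univ r <
      cliqueCount G Finset.univ r + cliqueCount G Finset.univ r := by
    rw [cliqueCount_univ_eq_sum (i := i) (j := j) hPc,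
      cliqueCount_univ_eq_sum (i := i) (j := j) hQc,
      cliqueCount_univ_eq_sum (i := i) (j := j) hcomp,
      ← Finset.sum_add_distrib, ← Finset.sum_add_distrib]
    simp only [hPr, hQr, cliqueCount_two_parts hij hPc hPt, cliqueCount_two_parts hij hQc hQt,
      cliqueCount_two_parts hij hcomp htf, hPi, hPj, hQi, hQj, ← ha, ← hb, ← add_mul]
    refine Finset.sum_lt_sum (fun z _ => Nat.mul_le_mul_right _ ?_)
      ⟨(4, r - 4), Finset.HasAntidiagonal.mem_antidiagonal.2 (by simp only; omega),
        Nat.mul_lt_mul_of_pos_right ?_ hrest⟩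
    · split <;> linarith only
    · simp only
      linarith only
  omega
end

section
/- Let t ≥ 2 be an integer and let c_1 ≥ c_2 ≥ ... ≥ c_t ≥ 1 be integers with c_1 ≤ c_{t−1} + 1. Let m' be an integer with 0 ≤ m' ≤ c_{t−1} − c_t. Set n := c_1 + ... + c_t and e := Σ_{1≤i<j≤t} c_i c_j − m'. Then k(n,e) = t, i.e., t is the smallest integer s with t_s(n) ≥ e. -/
open Finset in
/-- Counting identity for a complete multipartite graph presented by a colouring. -/
lemma two_mul_edgeCnt_add_sum_sq {V ι : Type*} [Fintype V] [Fintype ι] [DecidableEq ι]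
    (G : SimpleGraph V) (f : V → ι) (hG : ∀ u v, G.Adj u v ↔ f u ≠ f v) :
    2 * edgeCnt G + ∑ i, #{v | f v = i} ^ 2 = Fintype.card V ^ 2 := by
  classical
  have hdeg (v : V) : G.degree v + #{u | f u = f v} = Fintype.card V := by
    have h : G.neighborFinset v = ({u | ¬ f u = f v} : Finset V) := by
      ext u
      simp [hG, eq_comm]
    rw [← G.card_neighborFinset_eq_degree, h, add_comm, card_filter_add_card_filter_not, card_univ]
  have hsq : ∑ i, #{v | f v = i} ^ 2 = ∑ v, #{u | f u = f v} := by
    rw [← sum_fiberwise univ f]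
    refine sum_congr rfl fun i _ ↦ ?_
    rw [sum_congr rfl (g := fun _ ↦ #{u | f u = i}) fun v hv ↦ by rw [(mem_filter.1 hv).2],
      sum_const, smul_eq_mul, sq]
  rw [edgeCnt, ← SimpleGraph.coe_edgeFinset, Set.ncard_coe_finset,
    ← G.sum_degrees_eq_twice_card_edges, hsq, ← sum_add_distrib, sum_congr rfl fun v _ ↦ hdeg v,
    sum_const, card_univ, smul_eq_mul, sq]

open Finset in
lemma two_mul_sum_powersetCard_two_add_sum_sq {ι : Type*} [DecidableEq ι] (s : Finset ι)
    (c : ι → ℕ) :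
    2 * (∑ p ∈ s.powersetCard 2, ∏ i ∈ p, c i) + ∑ i ∈ s, c i ^ 2 = (∑ i ∈ s, c i) ^ 2 := by
  induction s using Finset.induction_on with
  | empty => simp
  | insert a s ha ih =>
    have hsplit : ∑ p ∈ (insert a s).powersetCard 2, ∏ i ∈ p, c i =
        (∑ p ∈ s.powersetCard 2, ∏ i ∈ p, c i) + c a * ∑ i ∈ s, c i := by
      rw [powersetCard_succ_insert ha, sum_union, sum_image, mul_sum, powersetCard_one, sum_map]
      · congr 1
        refine sum_congr rfl fun i hi ↦ ?_
        have : a ≠ i := fun h ↦ ha (h ▸ hi)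
        simp [prod_pair this]
      · intro p hp q hq h
        have hp' : a ∉ p := fun h ↦ ha ((mem_powersetCard.1 hp).1 h)
        have hq' : a ∉ q := fun h ↦ ha ((mem_powersetCard.1 hq).1 h)
        rw [← erase_insert hp', ← erase_insert hq', h]
      · refine disjoint_left.2 fun p hp hp' ↦ ?_
        obtain ⟨q, -, rfl⟩ := mem_image.1 hp'
        exact ha ((mem_powersetCard.1 hp).1 (mem_insert_self a q))
    rw [hsplit, sum_insert ha, sum_insert ha]
    linear_combination ih

/-- The complete multipartite graph with parts `c i` has at most as many edges as the Turán
graph with the same numbers of vertices and parts. -/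
lemma sum_powersetCard_two_le_tur (t : ℕ) (c : ℕ → ℕ) :
    ∑ p ∈ (Finset.Icc 1 t).powersetCard 2, ∏ i ∈ p, c i ≤
      tur t (∑ i ∈ Finset.Icc 1 t, c i) := by
  classical
  set V := Σ i : Finset.Icc 1 t, Fin (c i)
  let G : SimpleGraph V := (⊤ : SimpleGraph (Finset.Icc 1 t)).comap Sigma.fst
  have hcard : Fintype.card V = ∑ i ∈ Finset.Icc 1 t, c i := by
    simpa [V] using Finset.sum_attach (Finset.Icc 1 t) c
  have hcount := two_mul_edgeCnt_add_sum_sq G Sigma.fst (fun u v ↦ by simp [G])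
  have hpart (i : Finset.Icc 1 t) :
      (Finset.univ.filter fun v : V ↦ v.1 = i).card = c i := by
    rw [← Fintype.card_subtype, Fintype.card_congr (Equiv.sigmaSubtype i), Fintype.card_fin]
  simp_rw [hpart] at hcount
  rw [Finset.sum_coe_sort (Finset.Icc 1 t) (fun i ↦ c i ^ 2), hcard] at hcount
  have hsum := two_mul_sum_powersetCard_two_add_sum_sq (Finset.Icc 1 t) c
  have hfree : G.CliqueFree (t + 1) := by
    have hcol : G.Coloring (Finset.Icc 1 t) :=
      SimpleGraph.Coloring.mk Sigma.fst fun {u v} h ↦ by simpa [G] using h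
    exact hcol.colorable.cliqueFree (by simp)
  have hle : edgeCnt G ≤ tur t (Fintype.card V) := by
    rw [tur, edgeCnt, edgeCnt, ← SimpleGraph.coe_edgeFinset, ← SimpleGraph.coe_edgeFinset,
      Set.ncard_coe_finset, Set.ncard_coe_finset]
    convert! hfree.card_edgeFinset_le
    convert! SimpleGraph.card_edgeFinset_turanGraph
  rw [hcard] at hle
  lia

/-- A tangent-line bound for the Turán number, at the slope given by part size `b`. -/
lemma two_mul_tur_le {s r : ℕ} (hs : 1 ≤ s) (hsr : s ≤ r) (n : ℕ) (b : ℤ) :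
    2 * (tur s n : ℤ) ≤ n ^ 2 - ((2 * b + 1) * n - r * (b ^ 2 + b)) := by
  classical
  let f : Fin n → Fin r := fun v ↦ ⟨v % s, (Nat.mod_lt _ hs).trans_le hsr⟩
  have hcount := two_mul_edgeCnt_add_sum_sq (SimpleGraph.turanGraph n s) f
    (fun u v ↦ by simp [f, SimpleGraph.turanGraph_adj])
  set d : Fin r → ℕ := fun i ↦ (Finset.univ.filter fun v ↦ f v = i).card
  have hd : ∑ i, d i = n := by
    simpa using (Finset.card_eq_sum_card_fiberwise (f := f) (s := Finset.univ)
      (t := Finset.univ) (by simp)).symm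
  have hd' : ∑ i, (d i : ℤ) = n := by exact_mod_cast hd
  have hconv : ∑ i, ((2 * b + 1) * (d i : ℤ) - (b ^ 2 + b)) ≤ ∑ i, (d i : ℤ) ^ 2 := by
    refine Finset.sum_le_sum fun i _ ↦ ?_
    rcases le_or_gt (d i : ℤ) b with h | h <;> nlinarith
  rw [Finset.sum_sub_distrib, ← Finset.mul_sum, hd'] at hconv
  simp only [Finset.sum_const, Finset.card_univ, Fintype.card_fin, nsmul_eq_mul] at hconv
  have hcount' : 2 * (tur s n : ℤ) + ∑ i, (d i : ℤ) ^ 2 = n ^ 2 := by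
    rw [Fintype.card_fin] at hcount
    exact_mod_cast hcount
  linarith

/-- Let `t ≥ 2` and `c_1 ≥ ⋯ ≥ c_t ≥ 1` be integers with
`c_1 ≤ c_{t-1} + 1`, and let `0 ≤ m' ≤ c_{t-1} - c_t`. With `n := c_1 + ⋯ + c_t` and
`e := Σ_{i<j} c_i c_j - m'`, we have `k(n,e) = t`. -/
theorem k_of_balanced_multipartite (t : ℕ) (ht : 2 ≤ t) (c : ℕ → ℕ) (m' n e : ℕ)
    (hpos : 1 ≤ c t)
    (hmono : ∀ i j, 1 ≤ i → i ≤ j → j ≤ t → c j ≤ c i)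
    (hbal : c 1 ≤ c (t - 1) + 1)
    (hm : m' ≤ c (t - 1) - c t)
    (hn : n = ∑ i ∈ Finset.Icc 1 t, c i)
    (he : e = (∑ p ∈ (Finset.Icc 1 t).powersetCard 2, ∏ i ∈ p, c i) - m') :
    kk n e = t := by
  have hle : e ≤ tur t n := by
    rw [he, hn]
    exact (Nat.sub_le _ _).trans (sum_powersetCard_two_le_tur t c)
  have hlt (s : ℕ) (hs : 1 ≤ s) (hst : s < t) : tur s n < e := by
    obtain ⟨r, rfl⟩ : ∃ r, t = r + 1 := ⟨t - 1, by lia⟩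
    rw [Nat.add_sub_cancel] at hbal hm
    have hb := hmono r (r + 1) (by lia) (by lia) le_rfl
    have htur := two_mul_tur_le hs (Nat.lt_succ_iff.1 hst) n (c r)
    have hsum := two_mul_sum_powersetCard_two_add_sum_sq (Finset.Icc 1 (r + 1)) c
    have hsq : ∑ i ∈ Finset.Icc 1 r, (c i : ℤ) ^ 2 =
        ∑ i ∈ Finset.Icc 1 r, ((2 * (c r : ℤ) + 1) * c i - ((c r : ℤ) ^ 2 + c r)) := by
      refine Finset.sum_congr rfl fun i hi ↦ ?_
      obtain ⟨hi1, hir⟩ := Finset.mem_Icc.1 hi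
      have h1 := hmono 1 i le_rfl hi1 (by lia)
      have h2 := hmono i r hi1 hir (by lia)
      obtain h | h : c i = c r ∨ c i = c r + 1 := by lia
      all_goals rw [h]; push_cast; ring
    rw [← hn, Finset.sum_Icc_succ_top (by lia)] at hsum
    rw [Finset.sum_Icc_succ_top (by lia)] at hn
    rw [Finset.sum_sub_distrib, ← Finset.mul_sum] at hsq
    simp only [Finset.sum_const, Nat.card_Icc, Nat.add_sub_cancel, nsmul_eq_mul] at hsq
    suffices h : (tur s n : ℤ) + m' <
        (∑ p ∈ (Finset.Icc 1 (r + 1)).powersetCard 2, ∏ i ∈ p, c i : ℕ) by lia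
    have hnZ : (n : ℤ) = ∑ i ∈ Finset.Icc 1 r, (c i : ℤ) + c (r + 1) := by exact_mod_cast hn
    zify at hsum
    push_cast at hsum ⊢
    rw [hsq] at hsum
    have hmZ : (m' : ℤ) ≤ c r - c (r + 1) := by lia
    have hpZ : (1 : ℤ) ≤ c (r + 1) := by exact_mod_cast hpos
    have hbZ : (c (r + 1) : ℤ) ≤ c r := by exact_mod_cast hb
    have hSZ : ∑ i ∈ Finset.Icc 1 r, (c i : ℤ) = n - c (r + 1) := by linarith
    rw [hSZ] at hsum
    nlinarith [mul_nonneg (sub_nonneg.2 hpZ) (sub_nonneg.2 hbZ)]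
  refine le_antisymm (Nat.sInf_le ⟨by lia, hle⟩) (le_csInf ⟨t, by lia, hle⟩ ?_)
  rintro s ⟨hs, hes⟩
  by_contra! h
  exact (hlt s hs h).not_ge hes
end

section
/- Let t ≥ 2 be an integer and let c_1 ≥ c_2 ≥ ... ≥ c_t ≥ 1 be integers with c_1 ≤ c_{t−1} + 1. Let m' be an integer with 0 ≤ m' ≤ c_{t−1} − c_t. Set n := c_1 + ... + c_t and e := Σ_{1≤i<j≤t} c_i c_j − m'. Then a*(n,e) = (c_1, ..., c_t) and m*(n,e) = m'. -/
open Finset in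
theorem sum_powersetCard_two_insert {ι : Type*} [DecidableEq ι] {a : ι} {s : Finset ι}
    (ha : a ∉ s) (c : ι → ℕ) :
    ∑ p ∈ (insert a s).powersetCard 2, ∏ i ∈ p, c i =
      ∑ p ∈ s.powersetCard 2, ∏ i ∈ p, c i + c a * ∑ i ∈ s, c i := by
  have hdisj : Disjoint (s.powersetCard 2) ((s.powersetCard 1).image (insert a)) := by
    rw [disjoint_left]
    intro p hp hq
    obtain ⟨q, -, rfl⟩ := mem_image.1 hq
    exact ha ((mem_powersetCard.1 hp).1 (mem_insert_self _ _))
  rw [powersetCard_succ_insert ha 1, sum_union hdisj, powersetCard_one]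
  congr 1
  rw [sum_image]
  · rw [sum_map, mul_sum]
    refine sum_congr rfl fun i hi => ?_
    have : a ≠ i := fun h => ha (h ▸ hi)
    simp [prod_pair this]
  · intro p hp q hq h
    obtain ⟨i, hi, rfl⟩ := mem_map.1 hp
    obtain ⟨j, hj, rfl⟩ := mem_map.1 hq
    have hai : a ≠ i := fun h => ha (h ▸ hi)
    have haj : a ≠ j := fun h => ha (h ▸ hj)
    have h' := congrArg (fun u => erase u a) h
    simpa [erase_insert, hai, haj] using h'

open Finset in
theorem two_mul_sum_powersetCard_two {ι : Type*} (s : Finset ι) (c : ι → ℕ) :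
    2 * ∑ p ∈ s.powersetCard 2, ∏ i ∈ p, c i + ∑ i ∈ s, c i ^ 2 = (∑ i ∈ s, c i) ^ 2 := by
  classical
  induction s using Finset.induction_on with
  | empty => rw [powersetCard_eq_empty.2 (by simp)]; simp
  | insert a s ha ih =>
    rw [sum_powersetCard_two_insert ha, sum_insert ha, sum_insert ha]
    linear_combination ih

theorem tur_eq_card_edgeFinset (s N : ℕ) :
    tur s N = (SimpleGraph.turanGraph N s).edgeFinset.card := by
  rw [tur, edgeCnt, ← SimpleGraph.coe_edgeFinset, Set.ncard_coe_finset]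

theorem two_mul_tur {s : ℕ} (hs : 0 < s) (N : ℕ) :
    2 * tur s N + (2 * (N / s) + 1) * N = N ^ 2 + s * ((N / s) * (N / s + 1)) := by
  induction N using Nat.strong_induction_on with
  | _ N ih =>
    rcases lt_or_ge N s with h | h
    · have hc : tur s N = N.choose 2 := by
        have htop := (SimpleGraph.turanGraph_eq_top (n := N) (r := s)).2 (Or.inr h.le)
        rw [tur, edgeCnt, htop, ← SimpleGraph.coe_edgeFinset, Set.ncard_coe_finset,
          SimpleGraph.card_edgeFinset_top_eq_card_choose_two, Fintype.card_fin]
      rw [hc, Nat.div_eq_of_lt h, Nat.choose_two_right,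
        Nat.mul_div_cancel' (Nat.even_mul_pred_self N).two_dvd]
      cases N <;> simp
      ring
    · obtain ⟨M, rfl⟩ := Nat.exists_eq_add_of_le' h
      have hM := ih M (by omega)
      rw [tur_eq_card_edgeFinset, SimpleGraph.card_edgeFinset_turanGraph_add,
        ← tur_eq_card_edgeFinset, Nat.add_div_right _ hs]
      have hch : 2 * s.choose 2 = s * (s - 1) := by
        rw [Nat.choose_two_right, Nat.mul_div_cancel' (Nat.even_mul_pred_self s).two_dvd]
      obtain ⟨r, rfl⟩ := Nat.exists_eq_add_of_le' hs
      simp only [Nat.add_sub_cancel, Nat.succ_eq_add_one] at *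
      linear_combination hM + hch

theorem tur_succ {s : ℕ} (hs : 0 < s) (N : ℕ) :
    tur s (N + 1) + N / s = tur s N + N := by
  have h1 := two_mul_tur hs N
  have h2 := two_mul_tur hs (N + 1)
  rw [Nat.succ_div] at h2
  split_ifs at h2 with h
  · obtain ⟨k, hk⟩ := h
    have hq : N / s + 1 = k := by
      have := Nat.succ_div_of_dvd (a := N) (b := s) ⟨k, hk⟩
      rw [← this, hk, Nat.mul_div_cancel_left _ hs]
    rw [← hq] at hk
    nlinarith
  · nlinarith

theorem tur_mono {r s : ℕ} (hr : 0 < r) (h : r ≤ s) (N : ℕ) : tur r N ≤ tur s N := by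
  rw [tur_eq_card_edgeFinset, tur_eq_card_edgeFinset]
  exact (SimpleGraph.isTuranMaximal_turanGraph (hr.trans_le h)).2
    ((SimpleGraph.turanGraph_cliqueFree hr).mono (by omega))

open Finset in
theorem sum_powersetCard_two_le_tur_s16 {ι : Type*} {s : Finset ι} (hs : s.Nonempty) (c : ι → ℕ) :
    ∑ p ∈ s.powersetCard 2, ∏ i ∈ p, c i ≤ tur #s (∑ i ∈ s, c i) := by
  have h1 := two_mul_sum_powersetCard_two s c
  have h2 := two_mul_tur (card_pos.2 hs) (∑ i ∈ s, c i)
  generalize (∑ i ∈ s, c i) / #s = q at h2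
  have h3 : (2 * q + 1) * ∑ i ∈ s, c i ≤ ∑ i ∈ s, c i ^ 2 + #s * (q * (q + 1)) := by
    rw [mul_sum, ← smul_eq_mul (#s), ← sum_const, ← sum_add_distrib]
    refine sum_le_sum fun i _ => ?_
    rcases le_or_gt (c i) q with h | h
    · obtain ⟨k, rfl⟩ := Nat.exists_eq_add_of_le h
      nlinarith
    · obtain ⟨k, hk⟩ := Nat.exists_eq_add_of_lt h
      rw [hk]
      nlinarith
  linarith

open Finset in
theorem sum_powersetCard_two_eq_tur {ι : Type*} {s : Finset ι} (hs : s.Nonempty) {c : ι → ℕ}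
    (hc : ∀ i ∈ s, c i = (∑ i ∈ s, c i) / #s ∨ c i = (∑ i ∈ s, c i) / #s + 1) :
    ∑ p ∈ s.powersetCard 2, ∏ i ∈ p, c i = tur #s (∑ i ∈ s, c i) := by
  have h1 := two_mul_sum_powersetCard_two s c
  have h2 := two_mul_tur (card_pos.2 hs) (∑ i ∈ s, c i)
  generalize (∑ i ∈ s, c i) / #s = q at h2 hc
  have h3 : (2 * q + 1) * ∑ i ∈ s, c i = ∑ i ∈ s, c i ^ 2 + #s * (q * (q + 1)) := by
    rw [mul_sum, ← smul_eq_mul (#s), ← sum_const, ← sum_add_distrib]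
    refine sum_congr rfl fun i hi => ?_
    rcases hc i hi with h | h <;> rw [h] <;> ring
  linarith

open Finset in
/-- A nonincreasing vector of `s` integers that differ by at most one is determined by its sum. -/
theorem eq_div_add_ite_of_balanced {s : ℕ} (hs : 0 < s) {c : ℕ → ℕ}
    (hmono : ∀ i j, 1 ≤ i → i ≤ j → j ≤ s → c j ≤ c i) (hbal : c 1 ≤ c s + 1) :
    c s = (∑ i ∈ Icc 1 s, c i) / s ∧
      ∀ i ∈ Icc 1 s, c i = (∑ i ∈ Icc 1 s, c i) / s +
        if i ≤ (∑ i ∈ Icc 1 s, c i) % s then 1 else 0 := by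
  set F := (Icc 1 s).filter fun i => c i = c s + 1
  have hval : ∀ i ∈ Icc 1 s, c i = c s + if c i = c s + 1 then 1 else 0 := by
    intro i hi
    rw [mem_Icc] at hi
    have h1 := hmono 1 i le_rfl hi.1 hi.2
    have h2 := hmono i s hi.1 hi.2 le_rfl
    split_ifs <;> omega
  have hsum : ∑ i ∈ Icc 1 s, c i = #F + s * c s := by
    rw [sum_congr rfl hval, sum_add_distrib, ← card_filter]
    simp [F, add_comm]
  have hlt : #F < s := by
    have : F ⊆ Icc 1 (s - 1) := by
      intro i hi
      obtain ⟨hi, hci⟩ := mem_filter.1 hi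
      have : i ≠ s := by rintro rfl; omega
      rw [mem_Icc] at hi ⊢
      omega
    have := card_le_card this
    simp only [Nat.card_Icc] at this
    omega
  have hdiv : (∑ i ∈ Icc 1 s, c i) / s = c s := by
    rw [hsum, Nat.add_mul_div_left _ _ hs, Nat.div_eq_of_lt hlt, zero_add]
  have hmod : (∑ i ∈ Icc 1 s, c i) % s = #F := by
    rw [hsum, Nat.add_mul_mod_self_left, Nat.mod_eq_of_lt hlt]
  refine ⟨hdiv.symm, fun i hi => ?_⟩
  rw [hdiv, hmod]
  have hi' := mem_Icc.1 hi
  have hiff : c i = c s + 1 ↔ i ≤ #F := by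
    constructor
    · intro h
      have : Icc 1 i ⊆ F := by
        intro j hj
        rw [mem_Icc] at hj
        refine mem_filter.2 ⟨mem_Icc.2 ⟨hj.1, hj.2.trans hi'.2⟩, ?_⟩
        have h1 := hmono j i hj.1 hj.2 hi'.2
        have h2 := hmono 1 j le_rfl hj.1 (hj.2.trans hi'.2)
        omega
      simpa using card_le_card this
    · intro h
      by_contra hne
      have : F ⊆ Icc 1 (i - 1) := by
        intro j hj
        obtain ⟨hj, hcj⟩ := mem_filter.1 hj
        rw [mem_Icc] at hj ⊢
        refine ⟨hj.1, ?_⟩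
        by_contra hij
        have h1 := hmono i j hi'.1 (by omega) hj.2
        have h2 := hmono 1 i le_rfl hi'.1 hi'.2
        omega
      have := card_le_card this
      simp only [Nat.card_Icc] at this
      omega
  rw [← if_congr hiff rfl rfl]
  exact hval i hi

/-- Shrinking the last part of a complete multipartite graph, and moving its vertices to the
remaining balanced parts, loses at least `y - d + 1` edges if `d` is the size of the last part and
`y` the minimum of the others. -/
theorem tur_add_mul_lt_of_shrink {s N d y : ℕ} (hs : 0 < s) (hy : y ≤ N / s) (hdy : d ≤ y)
    (j a : ℕ) (h : d = a + j + 1) :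
    a * (N + j + 1) + tur s (N + j + 1) + (y - d) < d * N + tur s N := by
  induction j generalizing a with
  | zero =>
    have := tur_succ hs N
    subst h
    simp only [add_zero] at *
    have : a * (N + 1) = a * N + a := by ring
    have : (a + 1) * N = a * N + N := by ring
    omega
  | succ j ih =>
    have h1 := ih (a + 1) (by omega)
    have h2 := tur_succ hs (N + j + 1)
    have h3 : N / s ≤ (N + j + 1) / s := Nat.div_le_div_right (by omega)
    have h4 : a * (N + (j + 1) + 1) = a * (N + j + 1) + a := by ring
    have h5 : (a + 1) * (N + j + 1) = a * (N + j + 1) + (N + j + 1) := by ring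
    rw [h4, show N + (j + 1) + 1 = N + j + 1 + 1 by ring]
    omega

/-- Let `t ≥ 2` and `c_1 ≥ ⋯ ≥ c_t ≥ 1` be integers with
`c_1 ≤ c_{t-1} + 1`, and let `0 ≤ m' ≤ c_{t-1} - c_t`. With `n := c_1 + ⋯ + c_t` and
`e := Σ_{i<j} c_i c_j - m'`, we have `a*(n,e) = (c_1, …, c_t)` and `m*(n,e) = m'`. -/
theorem aStar_mStar_of_balanced_multipartite (t : ℕ) (ht : 2 ≤ t) (c : ℕ → ℕ) (m' n e : ℕ)
    (hpos : 1 ≤ c t)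
    (hmono : ∀ i j, 1 ≤ i → i ≤ j → j ≤ t → c j ≤ c i)
    (hbal : c 1 ≤ c (t - 1) + 1)
    (hm : m' ≤ c (t - 1) - c t)
    (hn : n = ∑ i ∈ Finset.Icc 1 t, c i)
    (he : e = (∑ p ∈ (Finset.Icc 1 t).powersetCard 2, ∏ i ∈ p, c i) - m') :
    kk n e = t ∧ (∀ i ∈ Finset.Icc 1 t, aStar n e i = c i) ∧ mStar n e = m' := by
  obtain ⟨s, rfl⟩ := Nat.exists_eq_add_of_le' (one_le_two.trans ht)
  have hs : 0 < s := by omega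
  rw [Nat.add_sub_cancel] at hbal hm
  obtain ⟨hcs, hci⟩ := eq_div_add_ite_of_balanced hs
    (fun i j hi hij hj => hmono i j hi hij (by omega)) hbal
  have hdy : c (s + 1) ≤ c s := hmono s (s + 1) hs (by omega) le_rfl
  have hne : (Finset.Icc 1 s).Nonempty := Finset.nonempty_Icc.2 hs
  have hIcc : Finset.Icc 1 (s + 1) = insert (s + 1) (Finset.Icc 1 s) :=
    (Finset.insert_Icc_right_eq_Icc_add_one (by omega)).symm
  have hnot : s + 1 ∉ Finset.Icc 1 s := by simp
  have hS := sum_powersetCard_two_insert hnot c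
  have hle := sum_powersetCard_two_le_tur_s16 (Finset.nonempty_Icc.2 (by omega : 1 ≤ s + 1)) c
  rw [← hn] at hle
  rw [← hIcc, sum_powersetCard_two_eq_tur hne fun i hi => ?_] at hS
  swap
  · rw [hci i hi, Nat.card_Icc, Nat.add_sub_cancel]
    split_ifs <;> simp
  simp only [Nat.card_Icc, Nat.add_sub_cancel] at hS hle
  rw [hIcc, Finset.sum_insert hnot] at hn
  set N := ∑ i ∈ Finset.Icc 1 s, c i
  set S := ∑ p ∈ (Finset.Icc 1 (s + 1)).powersetCard 2, ∏ i ∈ p, c i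
  have hlt : ∀ a < c (s + 1), a * (n - a) + tur s (n - a) < e := by
    intro a ha
    have := tur_add_mul_lt_of_shrink hs hcs.le hdy (c (s + 1) - a - 1) a (by omega)
    rw [show N + (c (s + 1) - a - 1) + 1 = n - a by omega] at this
    omega
  have hkk : kk n e = s + 1 := by
    refine le_antisymm (Nat.sInf_le ⟨by omega, by omega⟩)
      (le_csInf ⟨s + 1, by omega, by omega⟩ fun r hr => ?_)
    by_contra hrs
    have h1 := tur_mono hr.1 (by omega : r ≤ s) n
    have h2 := hlt 0 hpos
    have h3 := hr.2
    simp only [zero_mul, zero_add, Nat.sub_zero] at h2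
    omega
  have hnd : n - c (s + 1) = N := by omega
  have haLast : aLast n e = c (s + 1) := by
    have hmem : 1 ≤ c (s + 1) ∧
        e ≤ c (s + 1) * (n - c (s + 1)) + tur (kk n e - 1) (n - c (s + 1)) := by
      rw [hkk, Nat.add_sub_cancel, hnd]
      exact ⟨hpos, by omega⟩
    refine le_antisymm (Nat.sInf_le hmem) (le_csInf ⟨_, hmem⟩ fun a ha => ?_)
    by_contra hac
    have h1 := hlt a (by omega)
    have h2 := ha.2
    rw [hkk, Nat.add_sub_cancel] at h2
    omega
  have haStar : ∀ i ∈ Finset.Icc 1 (s + 1), aStar n e i = c i := by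
    intro i hi
    rw [aStar, hkk, haLast, Nat.add_sub_cancel, hnd]
    split_ifs with h h'
    · rw [h]
    all_goals
      rw [hIcc, Finset.mem_insert, or_iff_right h] at hi
      rw [hci i hi]
      simp [h']
  refine ⟨hkk, haStar, ?_⟩
  have hsum : ∑ p ∈ (Finset.Icc 1 (s + 1)).powersetCard 2, ∏ i ∈ p, aStar n e i = S :=
    Finset.sum_congr rfl fun p hp => Finset.prod_congr rfl fun i hi =>
      haStar i ((Finset.mem_powersetCard.1 hp).1 hi)
  have h0 := hlt 0 hpos
  rw [mStar, hkk, hsum]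
  omega
end

section
/- Let n, e be positive integers with e ≤ C(n,2) and let k = k(n,e). Then a_k*(n,e) equals the minimum, over all graphs G with n vertices and e edges together with a partition of V(G) into k independent sets of G, of the size of the smallest part of the partition. In other words, a_k* is the smallest possible part size that a k-partite (n,e)-graph can have. -/
lemma edgeCnt_eq_card_edgeFinset {V : Type*} (G : SimpleGraph V) [Fintype G.edgeSet] :
    edgeCnt G = G.edgeFinset.card := by
  rw [edgeCnt, ← SimpleGraph.coe_edgeFinset, Set.ncard_coe_finset]

/-- Turán's theorem for colorable graphs. -/
lemma SimpleGraph.Colorable.edgeCnt_le_tur {V : Type*} [Fintype V] {G : SimpleGraph V} {r : ℕ}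
    (hr : 0 < r) (hG : G.Colorable r) : edgeCnt G ≤ tur r (Fintype.card V) := by
  classical
  have hmax := SimpleGraph.isTuranMaximal_turanGraph (n := Fintype.card V) hr
  let f : V ≃ Fin (Fintype.card V) := Fintype.equivFin V
  have hfree : (G.map f.toEmbedding).CliqueFree (r + 1) :=
    (hG.cliqueFree (Nat.lt_succ_self r)).comap
      (SimpleGraph.Iso.map f G).symm.toEmbedding.toCopy.isContained
  have h := hmax.2 hfree
  have hcard : G.edgeFinset.card = (G.map f.toEmbedding).edgeFinset.card :=
    (SimpleGraph.Iso.map f G).card_edgeFinset_eq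
  rw [tur, edgeCnt_eq_card_edgeFinset, edgeCnt_eq_card_edgeFinset, hcard]
  convert h

/-- Edges of a properly `(r + 1)`-colored graph, split according to whether they meet a given
color class. -/
lemma edgeCnt_le_of_coloring {n r : ℕ} (hr : 0 < r) (G : SimpleGraph (Fin n))
    (P : Fin n → Fin (r + 1)) (hP : ∀ u v, G.Adj u v → P u ≠ P v) (j : Fin (r + 1)) :
    edgeCnt G ≤ {v | P v = j}.ncard * (n - {v | P v = j}.ncard) +
      tur r (n - {v | P v = j}.ncard) := by
  set S : Set (Fin n) := {v | P v = j} with hS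
  have hcompl : Sᶜ.ncard = n - S.ncard := by
    rw [Set.ncard_compl, Nat.card_eq_fintype_card, Fintype.card_fin]
  have hcol : (G.induce Sᶜ).Colorable r := by
    have c : (G.induce Sᶜ).Coloring {c : Fin (r + 1) // c ≠ j} :=
      SimpleGraph.Coloring.mk (fun v => ⟨P v, v.2⟩) (by
        intro u v huv h
        exact hP _ _ huv (congrArg Subtype.val h))
    have := c.colorable
    simpa using this
  have hin : edgeCnt (G.induce Sᶜ) ≤ tur r (n - S.ncard) := by
    have := hcol.edgeCnt_le_tur hr
    rwa [← Nat.card_eq_fintype_card, Nat.card_coe_set_eq, hcompl] at this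
  have hsub : G.edgeSet ⊆ (fun p : Fin n × Fin n => s(p.1, p.2)) '' (S ×ˢ Sᶜ) ∪
      (Sym2.map Subtype.val) '' (G.induce Sᶜ).edgeSet := by
    intro x
    induction x with
    | _ u v =>
      intro huv
      have huv : G.Adj u v := huv
      have hne := hP u v huv
      by_cases hu : P u = j
      · exact .inl ⟨(u, v), ⟨hu, fun hv => hne (hu.trans hv.symm)⟩, rfl⟩
      by_cases hv : P v = j
      · exact .inl ⟨(v, u), ⟨hv, hu⟩, Sym2.eq_swap⟩
      · exact .inr ⟨s(⟨u, hu⟩, ⟨v, hv⟩), huv, rfl⟩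
  calc edgeCnt G ≤ _ := Set.ncard_le_ncard hsub (Set.toFinite _)
    _ ≤ _ := Set.ncard_union_le _ _
    _ ≤ (S ×ˢ Sᶜ).ncard + edgeCnt (G.induce Sᶜ) :=
        add_le_add (Set.ncard_image_le (Set.toFinite _)) (Set.ncard_image_le (Set.toFinite _))
    _ ≤ _ := by rw [Set.ncard_prod, hcompl]; gcongr

/-- A complete `(r + 1)`-partite graph with one part of size `a` and the other parts balanced. -/
lemma exists_multipartite_of_mul_le {m a r : ℕ} (hr : 0 < r) (hra : r * a ≤ m) :
    ∃ (G : SimpleGraph (Fin (m + a))) (P : Fin (m + a) → Fin (r + 1)),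
      a * m + tur r m ≤ edgeCnt G ∧ (∀ u v, G.Adj u v → P u ≠ P v) ∧
      (∀ j, a ≤ {v | P v = j}.ncard) ∧ {v | P v = Fin.last r}.ncard = a := by
  let P : Fin (m + a) → Fin (r + 1) :=
    Fin.addCases (fun i => ⟨i % r, (Nat.mod_lt _ hr).trans (Nat.lt_succ_self r)⟩)
      (fun _ => Fin.last r)
  have hPl (i : Fin m) : (P (Fin.castAdd a i) : ℕ) = i % r := by simp [P]
  have hPr (i : Fin a) : P (Fin.natAdd m i) = Fin.last r := by simp [P]
  have hPl_ne (i : Fin m) : P (Fin.castAdd a i) ≠ Fin.last r := by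
    intro h
    have := congrArg Fin.val h
    rw [hPl, Fin.val_last] at this
    exact (Nat.mod_lt (i : ℕ) hr).ne this
  let G : SimpleGraph (Fin (m + a)) := SimpleGraph.comap P ⊤
  have hlast : {v | P v = Fin.last r} = Set.range (Fin.natAdd m : Fin a → Fin (m + a)) := by
    ext v
    induction v using Fin.addCases with
    | left i =>
      simp only [Set.mem_ofPred_eq, hPl_ne, Set.mem_range, false_iff]
      rintro ⟨x, hx⟩
      have := congrArg Fin.val hx
      simp at this
      omega
    | right i => simp [hPr]
  have hlastcard : {v | P v = Fin.last r}.ncard = a := by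
    rw [hlast, ← Set.image_univ, Set.ncard_image_of_injective _ (Fin.natAdd_injective a m),
      Set.ncard_univ, Nat.card_eq_fintype_card, Fintype.card_fin]
  refine ⟨G, P, ?_, fun u v h => h, fun j => ?_, hlastcard⟩
  · let f : Fin a × Fin m → Sym2 (Fin (m + a)) := fun p => s(Fin.natAdd m p.1, Fin.castAdd a p.2)
    have hf : f.Injective := by
      rintro ⟨x, y⟩ ⟨x', y'⟩ h
      simp only [f, Sym2.eq_iff, Fin.ext_iff, Fin.val_natAdd, Fin.val_castAdd] at h
      ext <;> simp <;> omega
    let g : Sym2 (Fin m) → Sym2 (Fin (m + a)) := Sym2.map (Fin.castAdd a)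
    have hg : g.Injective := Sym2.map.injective (Fin.castAdd_injective m a)
    have hdisj : Disjoint (Set.range f) (g '' (SimpleGraph.turanGraph m r).edgeSet) := by
      rw [Set.disjoint_left]
      rintro _ ⟨⟨x, y⟩, rfl⟩ ⟨z, -, hz⟩
      induction z with
      | _ u v =>
        simp only [f, g, Sym2.map_mk, Sym2.eq_iff, Fin.ext_iff, Fin.val_natAdd,
          Fin.val_castAdd] at hz
        omega
    have hsub : Set.range f ∪ g '' (SimpleGraph.turanGraph m r).edgeSet ⊆ G.edgeSet := by
      rintro _ (⟨⟨x, y⟩, rfl⟩ | ⟨z, hz, rfl⟩)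
      · change P _ ≠ P _
        rw [hPr]
        exact (hPl_ne y).symm
      · induction z with
        | _ u v =>
          change P _ ≠ P _
          have hz : (u : ℕ) % r ≠ v % r := hz
          intro h
          apply hz
          exact (hPl u).symm.trans ((congrArg Fin.val h).trans (hPl v))
    have h := Set.ncard_le_ncard hsub (Set.toFinite _)
    rwa [Set.ncard_union_eq hdisj (Set.toFinite _) (Set.toFinite _),
      Set.ncard_image_of_injective _ hg, ← Set.image_univ, Set.ncard_image_of_injective _ hf,
      Set.ncard_univ, Nat.card_eq_fintype_card, Fintype.card_prod, Fintype.card_fin,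
      Fintype.card_fin] at h
  · induction j using Fin.lastCases with
    | last => exact hlastcard.ge
    | cast j =>
      have hlt (i : Fin a) : (j : ℕ) + r * i < m := by
        have h1 := j.2
        have h2 : r * ((i : ℕ) + 1) ≤ r * a := Nat.mul_le_mul_left r i.2
        rw [mul_add] at h2
        omega
      let f : Fin a → Fin (m + a) := fun i => Fin.castAdd a ⟨j + r * i, hlt i⟩
      have hf : f.Injective := by
        intro x y h
        have := congrArg Fin.val h
        simp only [f, Fin.val_castAdd, add_right_inj] at this
        exact Fin.ext (Nat.eq_of_mul_eq_mul_left hr this)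
      have hsub : Set.range f ⊆ {v | P v = j.castSucc} := by
        rintro _ ⟨i, rfl⟩
        apply Fin.ext
        rw [hPl]
        simp [Nat.mod_eq_of_lt j.2]
      have h := Set.ncard_le_ncard hsub (Set.toFinite _)
      rwa [← Set.image_univ, Set.ncard_image_of_injective _ hf, Set.ncard_univ,
        Nat.card_eq_fintype_card, Fintype.card_fin] at h

lemma exists_le_edgeCnt_eq {V : Type*} [Finite V] (G : SimpleGraph V) {e : ℕ}
    (he : e ≤ edgeCnt G) : ∃ H ≤ G, edgeCnt H = e := by
  obtain ⟨s, hs, hse⟩ := Set.exists_subset_card_eq he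
  refine ⟨SimpleGraph.fromEdgeSet s, ?_, ?_⟩
  · intro u v h
    exact hs ((SimpleGraph.fromEdgeSet_adj s).1 h).1
  · rw [edgeCnt, SimpleGraph.edgeSet_fromEdgeSet, sdiff_eq_left.2, hse]
    rw [Set.disjoint_left]
    intro x hx
    exact G.not_isDiag_of_mem_edgeSet (hs hx)

lemma tur_self (n : ℕ) : tur n n = n.choose 2 := by
  classical
  rw [tur, SimpleGraph.turanGraph_eq_top.2 (.inr le_rfl), edgeCnt_eq_card_edgeFinset,
    SimpleGraph.card_edgeFinset_top_eq_card_choose_two, Fintype.card_fin]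

lemma tur_one (n : ℕ) : tur 1 n = 0 := by
  have h : SimpleGraph.turanGraph n 1 = ⊥ := by
    ext u v
    simp [SimpleGraph.turanGraph_adj, Nat.mod_one]
  rw [tur, h, edgeCnt, SimpleGraph.edgeSet_bot, Set.ncard_empty]

/-- For positive integers `n, e` with `e ≤ C(n,2)`, the quantity
`a_k*(n,e)` is the minimum, over all `(n,e)`-graphs `G` together with a partition of the
vertex set into `k = k(n,e)` independent sets, of the size of the smallest part. -/
theorem aLast_is_min_part_size (n e : ℕ) (hn : 0 < n) (he1 : 1 ≤ e)
    (he2 : e ≤ n.choose 2) :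
    IsLeast {a : ℕ | ∃ (G : SimpleGraph (Fin n)) (P : Fin n → Fin (kk n e)),
        edgeCnt G = e ∧ (∀ u v, G.Adj u v → P u ≠ P v) ∧
        a = sInf {b : ℕ | ∃ j : Fin (kk n e), b = {v | P v = j}.ncard}}
      (aLast n e) := by
  obtain ⟨hk1, hek⟩ : 1 ≤ kk n e ∧ e ≤ tur (kk n e) n :=
    Nat.sInf_mem (s := {s : ℕ | 1 ≤ s ∧ e ≤ tur s n}) ⟨n, hn, (tur_self n).symm ▸ he2⟩
  obtain ⟨r, hk⟩ : ∃ r, kk n e = r + 1 := ⟨kk n e - 1, by omega⟩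
  have hr : 0 < r := by
    rcases Nat.eq_zero_or_pos r with rfl | h
    · rw [hk, zero_add, tur_one] at hek
      omega
    · exact h
  have hlt : tur r n < e := by
    by_contra! h
    have : kk n e ≤ r := Nat.sInf_le ⟨hr, h⟩
    omega
  have haLast : aLast n e = sInf {a : ℕ | 1 ≤ a ∧ e ≤ a * (n - a) + tur r (n - a)} := by
    rw [aLast, hk, Nat.add_sub_cancel]
  have hpart (G : SimpleGraph (Fin n)) (P : Fin n → Fin (r + 1)) (hG : e ≤ edgeCnt G)
      (hP : ∀ u v, G.Adj u v → P u ≠ P v) (j : Fin (r + 1)) :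
      1 ≤ {v | P v = j}.ncard ∧ e ≤ {v | P v = j}.ncard * (n - {v | P v = j}.ncard) +
        tur r (n - {v | P v = j}.ncard) := by
    have h := hG.trans (edgeCnt_le_of_coloring hr G P hP j)
    refine ⟨?_, h⟩
    by_contra! h0
    rw [Nat.lt_one_iff.1 h0, zero_mul, zero_add, Nat.sub_zero] at h
    omega
  obtain ⟨b, hb, hbn⟩ : ∃ b, (1 ≤ b ∧ e ≤ b * (n - b) + tur r (n - b)) ∧ (r + 1) * b ≤ n := by
    let P : Fin n → Fin (r + 1) := fun v => ⟨v % (r + 1), Nat.mod_lt _ r.succ_pos⟩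
    have hP := hpart (SimpleGraph.turanGraph n (r + 1)) P (by rwa [hk] at hek)
      (fun u v h h' => h (congrArg Fin.val h'))
    obtain ⟨j, -, hj⟩ := Finset.exists_min_image Finset.univ
      (fun j => {v | P v = j}.ncard) Finset.univ_nonempty
    refine ⟨_, hP j, ?_⟩
    have hsum := Finset.card_eq_sum_card_fiberwise (s := (Finset.univ : Finset (Fin n)))
      (t := Finset.univ) (f := P) (fun _ _ => Finset.mem_coe.2 (Finset.mem_univ _))
    have hle := Finset.card_nsmul_le_sum (Finset.univ : Finset (Fin (r + 1)))
      (fun i => (Finset.univ.filter fun v => P v = i).card) ({v | P v = j}.ncard) (by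
        intro i hi
        have := hj i hi
        rwa [Set.ncard_eq_toFinset_card' {v | P v = i}, Set.toFinset_ofPred] at this)
    rw [← hsum] at hle
    simpa using hle
  obtain ⟨ha1, hae⟩ : 1 ≤ aLast n e ∧
      e ≤ aLast n e * (n - aLast n e) + tur r (n - aLast n e) := by
    rw [haLast]
    exact Nat.sInf_mem (s := {a : ℕ | 1 ≤ a ∧ e ≤ a * (n - a) + tur r (n - a)}) ⟨b, hb⟩
  have hab : aLast n e ≤ b := by
    rw [haLast]
    exact Nat.sInf_le hb
  rw [hk]
  constructor
  · generalize aLast n e = a at *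
    have han : (r + 1) * a ≤ n := (Nat.mul_le_mul_left _ hab).trans hbn
    rw [add_mul, one_mul] at han
    obtain ⟨m, rfl⟩ : ∃ m, n = m + a := ⟨n - a, by omega⟩
    rw [Nat.add_sub_cancel] at hae
    obtain ⟨G, P, hG, hP, hge, hlast⟩ := exists_multipartite_of_mul_le (m := m) (a := a) hr
      (by omega)
    obtain ⟨H, hHG, hH⟩ := exists_le_edgeCnt_eq G (hae.trans hG)
    refine ⟨H, P, hH, fun u v h => hP u v (hHG h), le_antisymm ?_ ?_⟩
    · refine le_csInf (Set.range_nonempty (fun j => {v | P v = j}.ncard) |>.mono ?_) ?_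
      · rintro _ ⟨j, rfl⟩
        exact ⟨j, rfl⟩
      rintro _ ⟨j, rfl⟩
      exact hge j
    · exact Nat.sInf_le ⟨Fin.last r, hlast.symm⟩
  · rintro _ ⟨G, P, hG, hP, rfl⟩
    obtain ⟨j, hj⟩ := Nat.sInf_mem
      (s := {b : ℕ | ∃ j : Fin (r + 1), b = {v | P v = j}.ncard}) ⟨_, Fin.last r, rfl⟩
    rw [hj, haLast]
    exact Nat.sInf_le (hpart G P hG.ge hP j)
end

section
/- Let n, e be positive integers with e ≤ C(n,2). Then the minimum chromatic number over all graphs with n vertices and e edges equals k(n,e); that is, min{χ(G) : G has n vertices and e edges} = min{s ≥ 1 : t_s(n) ≥ e}. -/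
lemma edgeCnt_le_tur_of_colorable {n s : ℕ} (hs : 0 < s) {G : SimpleGraph (Fin n)}
    (hG : G.Colorable s) : edgeCnt G ≤ tur s n := by
  classical
  rw [tur, edgeCnt_eq_card_edgeFinset, edgeCnt_eq_card_edgeFinset]
  convert (SimpleGraph.isTuranMaximal_turanGraph (n := n) hs).2
    (hG.cliqueFree (Nat.lt_succ_self s))

lemma turanGraph_colorable (n : ℕ) {s : ℕ} (hs : 0 < s) :
    (SimpleGraph.turanGraph n s).Colorable s :=
  ⟨SimpleGraph.Coloring.mk (fun v => ⟨v % s, Nat.mod_lt _ hs⟩) fun h heq =>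
    h (Fin.mk.inj_iff.1 heq)⟩

lemma kk_spec {n e : ℕ} (hn : 0 < n) (he : e ≤ n.choose 2) :
    1 ≤ kk n e ∧ e ≤ tur (kk n e) n :=
  Nat.sInf_mem (s := {s : ℕ | 1 ≤ s ∧ e ≤ tur s n}) ⟨n, hn, by rwa [tur_self]⟩

lemma kk_le_chromaticNumber {n : ℕ} (hn : 0 < n) (G : SimpleGraph (Fin n)) :
    (kk n (edgeCnt G) : ℕ∞) ≤ G.chromaticNumber := by
  have : Nonempty (Fin n) := ⟨⟨0, hn⟩⟩
  rw [SimpleGraph.le_chromaticNumber_iff_colorable]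
  intro m hm
  have hpos : 0 < m := by
    obtain ⟨c⟩ := hm
    exact (c ⟨0, hn⟩).pos
  exact Nat.sInf_le ⟨hpos, edgeCnt_le_tur_of_colorable hpos hm⟩

/-- For positive integers `n, e` with `e ≤ C(n,2)`, the minimum chromatic
number over all graphs with `n` vertices and `e` edges equals `k(n,e)`. -/
theorem min_chromatic_number_eq_k (n e : ℕ) (hn : 0 < n) (he1 : 1 ≤ e)
    (he2 : e ≤ n.choose 2) :
    IsLeast {x : ℕ∞ | ∃ G : SimpleGraph (Fin n), edgeCnt G = e ∧ G.chromaticNumber = x}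
      (kk n e : ℕ∞) := by
  refine ⟨?_, ?_⟩
  · obtain ⟨hk, hek⟩ := kk_spec hn he2
    obtain ⟨H, hH, rfl⟩ := exists_le_edgeCnt_eq _ hek
    exact ⟨H, rfl, le_antisymm
      ((turanGraph_colorable n hk).mono_left hH).chromaticNumber_le
      (kk_le_chromaticNumber hn H)⟩
  · rintro _ ⟨G, rfl, rfl⟩
    exact kk_le_chromaticNumber hn G
end
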